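/- arXiv:2401.00558 — 2 statements merged into one kernel-verified Lean document; each statement's English description precedes it below -/
import Mathlib

section
/- Let 0 < β < 1, α > 0, γ ∈ ℝ and λ ∈ ℝ. Then the Prabhakar (three-parameter Mittag-Leffler) kernels κ(x) = x^{β−1} E^γ_{α,β}(−λ x^α) and k(x) = x^{−β} E^{−γ}_{α,1−β}(−λ x^α) form a pair of Sonin kernels: for all x > 0, ∫₀ˣ (x−ξ)^{β−1} E^γ_{α,β}(−λ (x−ξ)^α) · ξ^{−β} E^{−γ}_{α,1−β}(−λ ξ^α) dξ = 1. -/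
open MeasureTheory Real

/-- The Pochhammer symbol `(γ)ₙ = γ(γ+1)⋯(γ+n-1)`. -/
noncomputable def poch (γ : ℝ) (n : ℕ) : ℝ := ∏ i ∈ Finset.range n, (γ + i)

/-- The three-parameter Mittag-Leffler (Prabhakar) function
`E^γ_{α,β}(z) = Σₙ (γ)ₙ/(n!·Γ(αn+β))·zⁿ`. -/
noncomputable def prabhakar (γ α β z : ℝ) : ℝ :=
  ∑' n : ℕ, poch γ n / ((n.factorial : ℝ) * Real.Gamma (α * n + β)) * z ^ n

open Filter Topology

lemma poch_eq_factorial_mul_choose (γ : ℝ) (n : ℕ) :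
    poch γ n = n.factorial * ((-1) ^ n * Ring.choose (-γ) n) := by
  have h := Ring.factorial_nsmul_multichoose_eq_ascPochhammer γ n
  have hp : (ascPochhammer ℝ n).eval γ = poch γ n := by
    induction n with
    | zero => simp [poch]
    | succ n ih =>
      rw [ascPochhammer_succ_eval, ih (Ring.factorial_nsmul_multichoose_eq_ascPochhammer γ n), poch,
        poch, Finset.prod_range_succ]
  rw [Polynomial.ascPochhammer_smeval_eq_eval, hp] at h
  rw [← h, Ring.choose_neg, nsmul_eq_mul, Ring.multichoose_eq, Int.negOnePow_def]
  congr 1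
  rw [Units.smul_def, zsmul_eq_mul, ← mul_assoc]
  simp [← mul_pow]

/-- The Chu–Vandermonde identity for opposite parameters: the Cauchy product of the binomial
series of `(1 - z)^(-γ)` and `(1 - z)^γ` is `1`. -/
lemma sum_antidiagonal_poch_mul_poch_neg (γ : ℝ) (k : ℕ) :
    ∑ p ∈ Finset.HasAntidiagonal.antidiagonal k,
      (poch γ p.1 / p.1.factorial) * (poch (-γ) p.2 / p.2.factorial) = if k = 0 then 1 else 0 := by
  have h := Ring.add_choose_eq (r := -γ) (s := γ) k (Commute.all _ _)
  rw [neg_add_cancel, Ring.choose_zero_ite] at h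
  have h2 : ∀ p ∈ Finset.HasAntidiagonal.antidiagonal k,
      (poch γ p.1 / p.1.factorial) * (poch (-γ) p.2 / p.2.factorial) =
        (-1) ^ k * (Ring.choose (-γ) p.1 * Ring.choose γ p.2) := by
    intro p hp
    have h1 : (p.1.factorial : ℝ) ≠ 0 := by positivity
    have h2 : (p.2.factorial : ℝ) ≠ 0 := by positivity
    rw [poch_eq_factorial_mul_choose, poch_eq_factorial_mul_choose, neg_neg,
      mul_div_cancel_left₀ _ h1, mul_div_cancel_left₀ _ h2, ← Finset.HasAntidiagonal.mem_antidiagonal.1 hp, pow_add]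
    ring
  rw [Finset.sum_congr rfl h2, ← Finset.mul_sum, ← h]
  split_ifs with hk <;> simp [hk]

lemma abs_poch_div_factorial_le (γ : ℝ) (n : ℕ) :
    |poch γ n / n.factorial| ≤ (|γ| + 1) ^ n := by
  induction n with
  | zero => simp [poch]
  | succ n ih =>
    have e : poch γ (n + 1) / (n + 1).factorial =
        (poch γ n / n.factorial) * ((γ + n) / (n + 1)) := by
      rw [poch, poch, Finset.prod_range_succ, Nat.factorial_succ]
      push_cast
      field_simp
    rw [e, abs_mul, pow_succ]
    gcongr
    have hn : (0 : ℝ) < n + 1 := by positivity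
    rw [abs_div, abs_of_pos hn, div_le_iff₀ hn]
    have h1 : |γ + n| ≤ |γ| + n := (abs_add_le _ _).trans (by simp)
    nlinarith [abs_nonneg γ, mul_nonneg (abs_nonneg γ) (Nat.cast_nonneg (α := ℝ) n)]

lemma Gamma_mul_rpow_le_Gamma_add {s a : ℝ} (hs : 1 < s) (ha : 0 < a) :
    Gamma s * (s - 1) ^ a ≤ Gamma (s + a) := by
  have h := Real.convexOn_log_Gamma.slope_mono_adjacent (x := s - 1) (y := s) (z := s + a)
    (by simpa using hs) (by simp only [Set.mem_Ioi]; linarith) (by linarith) (by linarith)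
  have hs1 : 0 < s - 1 := by linarith
  have hG : Gamma s = (s - 1) * Gamma (s - 1) := by
    simpa using Real.Gamma_add_one hs1.ne'
  have hp := Real.Gamma_pos_of_pos hs1
  have hps := Real.Gamma_pos_of_pos (show 0 < s by linarith)
  have hpa := Real.Gamma_pos_of_pos (show 0 < s + a by linarith)
  have hl : log (Gamma s) = log (s - 1) + log (Gamma (s - 1)) := by
    rw [hG, Real.log_mul hs1.ne' hp.ne']
  simp only [Function.comp_apply, sub_sub_cancel, div_one, add_sub_cancel_left] at h
  rw [le_div_iff₀ ha] at h
  rw [← Real.log_le_log_iff (by positivity) hpa,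
    Real.log_mul hps.ne' (by positivity), Real.log_rpow hs1]
  nlinarith

lemma summable_pow_div_Gamma {α β : ℝ} (hα : 0 < α) (hβ : 0 < β) {R : ℝ} (hR : 0 < R) :
    Summable fun n : ℕ => R ^ n / Gamma (α * n + β) := by
  have hpos : ∀ n : ℕ, 0 < Gamma (α * n + β) := fun n => Real.Gamma_pos_of_pos (by positivity)
  have hs : Tendsto (fun n : ℕ => α * (n : ℝ) + β - 1) atTop atTop :=
    tendsto_atTop_add_const_right _ _ (tendsto_atTop_add_const_right _ _
      (tendsto_natCast_atTop_atTop.const_mul_atTop hα))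
  refine summable_of_ratio_norm_eventually_le (r := 1 / 2) (by norm_num) ?_
  filter_upwards [((tendsto_rpow_atTop hα).comp hs).eventually_ge_atTop (2 * R),
    hs.eventually_gt_atTop 0] with n h1 h2
  have hG := Gamma_mul_rpow_le_Gamma_add (s := α * n + β) (by linarith) hα
  have e : α * ((n + 1 : ℕ) : ℝ) + β = α * n + β + α := by push_cast; ring
  have hp' := hpos (n + 1)
  rw [e] at hp' ⊢
  rw [Real.norm_of_nonneg (by positivity),
    Real.norm_of_nonneg (div_nonneg (by positivity) (hpos n).le), div_mul_div_comm,
    div_le_div_iff₀ hp' (by linarith [hpos n])]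
  have h3 : Gamma (α * n + β) * (2 * R) ≤ Gamma (α * n + β + α) :=
    (mul_le_mul_of_nonneg_left h1 (hpos n).le).trans hG
  calc R ^ (n + 1) * (2 * Gamma (α * n + β)) = R ^ n * (Gamma (α * n + β) * (2 * R)) := by ring
    _ ≤ R ^ n * Gamma (α * n + β + α) := by gcongr
    _ = _ := by ring

lemma summable_norm_prabhakar_term (γ : ℝ) {α β : ℝ} (hα : 0 < α) (hβ : 0 < β) (z : ℝ) :
    Summable fun n : ℕ =>
      ‖poch γ n / ((n.factorial : ℝ) * Real.Gamma (α * n + β)) * z ^ n‖ := by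
  refine Summable.of_nonneg_of_le (fun _ => norm_nonneg _) (fun n => ?_)
    (summable_pow_div_Gamma hα hβ (R := (|γ| + 1) * (|z| + 1)) (by positivity))
  have hpos : 0 < Gamma (α * n + β) := Real.Gamma_pos_of_pos (by positivity)
  rw [← div_div, Real.norm_eq_abs, abs_mul, abs_div, abs_of_pos hpos, abs_pow, mul_pow,
    div_mul_eq_mul_div]
  gcongr
  · exact abs_poch_div_factorial_le γ n
  · linarith

lemma integral_sub_rpow_mul_rpow {s t x : ℝ} (hs : 0 < s) (ht : 0 < t) (hx : 0 < x) :
    ∫ ξ in (0:ℝ)..x, (x - ξ) ^ (s - 1) * ξ ^ (t - 1) =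
      Gamma s * Gamma t / Gamma (s + t) * x ^ (s + t - 1) := by
  have h := Complex.betaIntegral_scaled t s hx
  rw [Complex.betaIntegral_eq_Gamma_mul_div t s (by simpa) (by simpa)] at h
  have e : ∫ ξ in (0:ℝ)..x, (ξ : ℂ) ^ ((t : ℂ) - 1) * ((x : ℂ) - ξ) ^ ((s : ℂ) - 1) =
      ((∫ ξ in (0:ℝ)..x, (x - ξ) ^ (s - 1) * ξ ^ (t - 1) : ℝ) : ℂ) := by
    rw [← intervalIntegral.integral_ofReal]
    refine intervalIntegral.integral_congr fun ξ hξ => ?_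
    rw [Set.uIcc_of_le hx.le] at hξ
    rw [Complex.ofReal_mul, Complex.ofReal_cpow (sub_nonneg.2 hξ.2), Complex.ofReal_cpow hξ.1]
    push_cast
    ring
  rw [e] at h
  apply Complex.ofReal_injective
  rw [h]
  rw [Complex.ofReal_mul, Complex.ofReal_cpow hx.le, Complex.ofReal_div, Complex.ofReal_mul,
    ← Complex.Gamma_ofReal, ← Complex.Gamma_ofReal, ← Complex.Gamma_ofReal]
  push_cast
  rw [add_comm (t : ℂ) s]
  ring

lemma intervalIntegrable_sub_rpow_mul_rpow {s t x : ℝ} (hs : 0 < s) (ht : 0 < t) (hx : 0 < x) :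
    IntervalIntegrable (fun ξ => (x - ξ) ^ (s - 1) * ξ ^ (t - 1)) volume 0 x := by
  by_contra h
  have h0 := integral_sub_rpow_mul_rpow hs ht hx
  rw [intervalIntegral.integral_undef h] at h0
  have := Real.Gamma_pos_of_pos hs
  have := Real.Gamma_pos_of_pos ht
  have := Real.Gamma_pos_of_pos (add_pos hs ht)
  have : 0 < Gamma s * Gamma t / Gamma (s + t) * x ^ (s + t - 1) := by positivity
  linarith

/-- Termwise convolution of the two Prabhakar series. -/
lemma integral_prabhakar_term_mul {α β x : ℝ} (hβ0 : 0 < β) (hβ1 : β < 1) (hα : 0 < α)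
    (hx : 0 < x) (γ δ lam : ℝ) (n m : ℕ) :
    ∫ ξ in (0:ℝ)..x,
      ((x - ξ) ^ (β - 1) * (poch γ n / ((n.factorial : ℝ) * Gamma (α * n + β)) *
        (-(lam * (x - ξ) ^ α)) ^ n)) *
      (ξ ^ (-β) * (poch δ m / ((m.factorial : ℝ) * Gamma (α * m + (1 - β))) *
        (-(lam * ξ ^ α)) ^ m)) =
    (poch γ n / n.factorial) * (poch δ m / m.factorial) *
      ((-(lam * x ^ α)) ^ (n + m) / Gamma (α * (n + m : ℕ) + 1)) := by
  have hn : 0 < α * n + β := by positivity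
  have hm : 0 < α * m + (1 - β) := by
    have : 0 < 1 - β := by linarith
    positivity
  have e : ∀ ξ ∈ Set.Ioo 0 x,
      ((x - ξ) ^ (β - 1) * (poch γ n / ((n.factorial : ℝ) * Gamma (α * n + β)) *
        (-(lam * (x - ξ) ^ α)) ^ n)) *
      (ξ ^ (-β) * (poch δ m / ((m.factorial : ℝ) * Gamma (α * m + (1 - β))) *
        (-(lam * ξ ^ α)) ^ m)) =
      (poch γ n / ((n.factorial : ℝ) * Gamma (α * n + β)) *
        (poch δ m / ((m.factorial : ℝ) * Gamma (α * m + (1 - β)))) * (-lam) ^ (n + m)) *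
        ((x - ξ) ^ (α * n + β - 1) * ξ ^ (α * m + (1 - β) - 1)) := by
    intro ξ hξ
    have h1 : 0 < x - ξ := sub_pos.2 hξ.2
    rw [add_sub_assoc, Real.rpow_add h1, Real.rpow_mul h1.le, Real.rpow_natCast,
      show α * m + (1 - β) - 1 = α * m + -β by ring, Real.rpow_add hξ.1, Real.rpow_mul hξ.1.le,
      Real.rpow_natCast, ← neg_mul, ← neg_mul, mul_pow, mul_pow, pow_add]
    ring
  rw [intervalIntegral.integral_of_le hx.le, integral_Ioc_eq_integral_Ioo,
    setIntegral_congr_fun measurableSet_Ioo e, ← integral_Ioc_eq_integral_Ioo,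
    ← intervalIntegral.integral_of_le hx.le, intervalIntegral.integral_const_mul,
    integral_sub_rpow_mul_rpow hn hm hx,
    show α * n + β + (α * m + (1 - β)) = α * (n + m : ℕ) + 1 by push_cast; ring,
    add_sub_cancel_right, Real.rpow_mul hx.le, Real.rpow_natCast, ← neg_mul, mul_pow]
  have := (Real.Gamma_pos_of_pos hn).ne'
  have := (Real.Gamma_pos_of_pos hm).ne'
  field_simp

/-- The convolution of the two Prabhakar kernels is the double series of the termwise
convolutions. -/
lemma hasSum_integral_prabhakar_mul {α β x : ℝ} (hβ0 : 0 < β) (hβ1 : β < 1) (hα : 0 < α)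
    (hx : 0 < x) (γ δ lam : ℝ) :
    HasSum (fun p : ℕ × ℕ => (poch γ p.1 / p.1.factorial) * (poch δ p.2 / p.2.factorial) *
      ((-(lam * x ^ α)) ^ (p.1 + p.2) / Gamma (α * (p.1 + p.2 : ℕ) + 1)))
    (∫ ξ in (0:ℝ)..x, ((x - ξ) ^ (β - 1) * prabhakar γ α β (-(lam * (x - ξ) ^ α))) *
      (ξ ^ (-β) * prabhakar δ α (1 - β) (-(lam * ξ ^ α)))) := by
  have hβ' : 0 < 1 - β := by linarith
  simp_rw [← integral_prabhakar_term_mul hβ0 hβ1 hα hx γ δ lam]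
  have hS : Summable fun p : ℕ × ℕ =>
      ‖poch γ p.1 / ((p.1.factorial : ℝ) * Gamma (α * p.1 + β)) * (lam * x ^ α) ^ p.1‖ *
      ‖poch δ p.2 / ((p.2.factorial : ℝ) * Gamma (α * p.2 + (1 - β))) * (lam * x ^ α) ^ p.2‖ :=
    (summable_norm_prabhakar_term γ hα hβ0 _).mul_of_nonneg
      (summable_norm_prabhakar_term δ hα hβ' _) (fun _ => norm_nonneg _) (fun _ => norm_nonneg _)
  refine intervalIntegral.hasSum_integral_of_dominated_convergence
    (fun p ξ =>
      (‖poch γ p.1 / ((p.1.factorial : ℝ) * Gamma (α * p.1 + β)) * (lam * x ^ α) ^ p.1‖ *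
      ‖poch δ p.2 / ((p.2.factorial : ℝ) * Gamma (α * p.2 + (1 - β))) * (lam * x ^ α) ^ p.2‖) *
        ((x - ξ) ^ (β - 1) * ξ ^ (-β))) ?_ ?_ ?_ ?_ ?_
  · intro p
    exact Measurable.aestronglyMeasurable (by fun_prop)
  · refine fun p => Eventually.of_forall fun ξ hξ => ?_
    rw [Set.uIoc_of_le hx.le] at hξ
    have h1 : 0 ≤ x - ξ := sub_nonneg.2 hξ.2
    have h2 : x - ξ ≤ x := by linarith [hξ.1]
    have h3 : 0 ≤ ξ := hξ.1.le
    have key : ∀ (c y : ℝ) (n : ℕ), 0 ≤ y → y ≤ x →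
        ‖c * (-(lam * y ^ α)) ^ n‖ ≤ ‖c * (lam * x ^ α) ^ n‖ := by
      intro c y n hy hyx
      rw [norm_mul, norm_mul, norm_pow, norm_pow, norm_neg, norm_mul, norm_mul,
        Real.norm_of_nonneg (Real.rpow_nonneg hy _), Real.norm_of_nonneg (Real.rpow_nonneg hx.le _)]
      gcongr
    rw [norm_mul, norm_mul, norm_mul (ξ ^ (-β)), Real.norm_of_nonneg (Real.rpow_nonneg h1 _),
      Real.norm_of_nonneg (Real.rpow_nonneg h3 _), mul_mul_mul_comm, mul_comm]
    gcongr
    · exact key _ _ _ h1 h2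
    · exact key _ _ _ h3 hξ.2
  · exact Eventually.of_forall fun ξ _ => hS.mul_right _
  · simp_rw [tsum_mul_right]
    have h := intervalIntegrable_sub_rpow_mul_rpow hβ0 hβ' hx
    rw [show 1 - β - 1 = -β by ring] at h
    exact h.const_mul _
  · refine Eventually.of_forall fun ξ _ => ?_
    have ha := summable_norm_prabhakar_term γ hα hβ0 (-(lam * (x - ξ) ^ α))
    have hb := summable_norm_prabhakar_term δ hα hβ' (-(lam * ξ ^ α))
    have hab := summable_mul_of_summable_norm ha hb
    have h := (ha.of_norm.hasSum.mul hb.of_norm.hasSum hab).mul_left ((x - ξ) ^ (β - 1) * ξ ^ (-β))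
    simp only [mul_mul_mul_comm ((x - ξ) ^ (β - 1)) (ξ ^ (-β))] at h
    exact h

/-- The Prabhakar kernels `x^{β-1}E^γ_{α,β}(-λxᵅ)` and `x^{-β}E^{-γ}_{α,1-β}(-λxᵅ)`
form a pair of Sonin kernels. -/
theorem prabhakar_kernels_sonin (α β γ lam : ℝ) (hβ0 : 0 < β) (hβ1 : β < 1) (hα : 0 < α)
    (x : ℝ) (hx : 0 < x) :
    ∫ ξ in (0:ℝ)..x, ((x - ξ) ^ (β - 1) * prabhakar γ α β (-(lam * (x - ξ) ^ α))) *
      (ξ ^ (-β) * prabhakar (-γ) α (1 - β) (-(lam * ξ ^ α))) = 1 := by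
  have h := hasSum_integral_prabhakar_mul hβ0 hβ1 hα hx γ (-γ) lam
  rw [← Finset.HasAntidiagonal.sigmaAntidiagonalEquivProd.hasSum_iff] at h
  have h' := h.sigma fun k => hasSum_fintype _
  refine h'.unique ?_
  convert hasSum_ite_eq (0 : ℕ) (1 : ℝ) using 2 with k
  rw [Finset.univ_eq_attach]
  refine (Finset.sum_attach (Finset.HasAntidiagonal.antidiagonal k) (fun p : ℕ × ℕ =>
    (poch γ p.1 / p.1.factorial) * (poch (-γ) p.2 / p.2.factorial) *
      ((-(lam * x ^ α)) ^ (p.1 + p.2) / Gamma (α * (p.1 + p.2 : ℕ) + 1)))).trans ?_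
  rw [Finset.sum_congr rfl fun p hp => by rw [Finset.HasAntidiagonal.mem_antidiagonal.1 hp], ← Finset.sum_mul,
    sum_antidiagonal_poch_mul_poch_neg]
  split_ifs with hk <;> simp [hk]
end

section
/- Let 0 < β < 1, α₁ > 0, α₂ > 0, γ ∈ ℝ and λ₁, λ₂ ∈ ℝ. Then the kernels κ(x) = x^{β−1} φ₃(γ; (α₁,α₂;β); −λ₁ x^{α₁}, λ₂ x^{α₂}) and k(x) = x^{−β} φ₃(−γ; (α₁,α₂;1−β); −λ₁ x^{α₁}, −λ₂ x^{α₂}) form a pair of Sonin kernels: for all x > 0, (κ * k)(x) = 1. -/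
open MeasureTheory Real

/-- The generalized Horn-type function
`φ₃(γ;(α₁,α₂;β);y,z) = Σ_{m,n} (γ)ₘ/Γ(α₁m+α₂n+β) · yᵐzⁿ/(m!n!)`. -/
noncomputable def phi3 (γ α₁ α₂ β y z : ℝ) : ℝ :=
  ∑' q : ℕ × ℕ, poch γ q.1 / Real.Gamma (α₁ * q.1 + α₂ * q.2 + β) * y ^ q.1 * z ^ q.2 /
    ((q.1.factorial : ℝ) * (q.2.factorial : ℝ))

open Finset.HasAntidiagonal (antidiagonal mem_antidiagonal)

lemma poch_succ (γ : ℝ) (n : ℕ) : poch γ (n + 1) = poch γ n * (γ + n) := by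
  simp [poch, Finset.prod_range_succ]

/-- The coefficients `(γ)ₙ / n!` of the binomial series `(1 - t) ^ (-γ)`. -/
noncomputable def pochDiv (γ : ℝ) (n : ℕ) : ℝ := poch γ n / n.factorial

lemma pochDiv_zero (γ : ℝ) : pochDiv γ 0 = 1 := by simp [pochDiv, poch]

lemma succ_mul_pochDiv (γ : ℝ) (n : ℕ) :
    ((n : ℝ) + 1) * pochDiv γ (n + 1) = (γ + n) * pochDiv γ n := by
  have h1 : (n.factorial : ℝ) ≠ 0 := by positivity
  have h2 : (n : ℝ) + 1 ≠ 0 := by positivity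
  simp only [pochDiv, poch_succ, Nat.factorial_succ]
  push_cast
  field_simp

lemma abs_pochDiv_le (γ : ℝ) (n : ℕ) : |pochDiv γ n| ≤ (1 + |γ|) ^ n := by
  induction n with
  | zero => simp [pochDiv_zero]
  | succ n ih =>
    have hn : (0 : ℝ) < (n : ℝ) + 1 := by positivity
    have h := congrArg abs (succ_mul_pochDiv γ n)
    rw [abs_mul, abs_mul, abs_of_pos hn] at h
    have h1 : |γ + n| ≤ ((n : ℝ) + 1) * (1 + |γ|) := by
      have := abs_add_le γ (n : ℝ)
      rw [Nat.abs_cast] at this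
      nlinarith [abs_nonneg γ, mul_nonneg (Nat.cast_nonneg (α := ℝ) n) (abs_nonneg γ)]
    have h2 : |γ + n| * |pochDiv γ n| ≤ ((n : ℝ) + 1) * (1 + |γ|) * (1 + |γ|) ^ n :=
      mul_le_mul h1 ih (abs_nonneg _) (by positivity)
    rw [← h, mul_assoc] at h2
    rw [pow_succ']
    exact le_of_mul_le_mul_left h2 hn

/-- Recurrence in `n` for the Cauchy product of two binomial series. -/
lemma succ_mul_sum_antidiagonal_pochDiv (a b : ℝ) (n : ℕ) :
    ((n : ℝ) + 1) * ∑ p ∈ antidiagonal (n + 1), pochDiv a p.1 * pochDiv b p.2 =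
      (a + b + n) * ∑ p ∈ antidiagonal n, pochDiv a p.1 * pochDiv b p.2 := by
  have split : ((n : ℝ) + 1) *
      ∑ p ∈ antidiagonal (n + 1), pochDiv a p.1 * pochDiv b p.2 =
      ∑ p ∈ antidiagonal (n + 1), (p.1 * pochDiv a p.1) * pochDiv b p.2 +
      ∑ p ∈ antidiagonal (n + 1), pochDiv a p.1 * (p.2 * pochDiv b p.2) := by
    rw [Finset.mul_sum, ← Finset.sum_add_distrib]
    refine Finset.sum_congr rfl fun p hp => ?_
    have : (p.1 : ℝ) + p.2 = n + 1 := by exact_mod_cast mem_antidiagonal.1 hp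
    rw [← this]; ring
  rw [split, Finset.Nat.sum_antidiagonal_succ, Finset.Nat.sum_antidiagonal_succ']
  simp only [Nat.cast_zero, zero_mul, mul_zero, zero_add, Nat.cast_add, Nat.cast_one,
    succ_mul_pochDiv]
  rw [← Finset.sum_add_distrib, Finset.mul_sum]
  refine Finset.sum_congr rfl fun p hp => ?_
  have : (p.1 : ℝ) + p.2 = n := by exact_mod_cast mem_antidiagonal.1 hp
  rw [← this]; ring

lemma sum_antidiagonal_pochDiv_neg (γ : ℝ) (n : ℕ) :
    ∑ p ∈ antidiagonal n, pochDiv γ p.1 * pochDiv (-γ) p.2 = if n = 0 then 1 else 0 := by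
  induction n with
  | zero => simp [pochDiv_zero]
  | succ n ih =>
    have h := succ_mul_sum_antidiagonal_pochDiv γ (-γ) n
    have h0 : (γ + -γ + n) *
        ∑ p ∈ antidiagonal n, pochDiv γ p.1 * pochDiv (-γ) p.2 = 0 := by
      rw [ih]; split_ifs with hn <;> simp [hn]
    rw [h0] at h
    simpa using (mul_eq_zero.1 h).resolve_left (by positivity)

lemma sum_antidiagonal_pow_div_factorial_neg (c : ℝ) (n : ℕ) :
    ∑ p ∈ antidiagonal n, c ^ p.1 / p.1.factorial * ((-c) ^ p.2 / p.2.factorial) =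
      if n = 0 then 1 else 0 := by
  have h : (0 : ℝ) ^ n = ∑ p ∈ antidiagonal n, (n.choose p.1 : ℝ) *
      (c ^ p.1 * (-c) ^ p.2) := by
    rw [← add_neg_cancel c, (Commute.all c (-c)).add_pow']
    simp [nsmul_eq_mul]
  have h' : ∑ p ∈ antidiagonal n, c ^ p.1 / p.1.factorial * ((-c) ^ p.2 / p.2.factorial) =
      (0 : ℝ) ^ n / n.factorial := by
    rw [h, Finset.sum_div]
    refine Finset.sum_congr rfl fun p hp => ?_
    obtain rfl := mem_antidiagonal.1 hp
    rw [Nat.choose_symm_add, Nat.add_choose]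
    have := Nat.factorial_mul_factorial_dvd_factorial_add p.1 p.2
    rw [Nat.cast_div this (by positivity)]
    have h3 : ((p.1 + p.2).factorial : ℝ) ≠ 0 := by positivity
    push_cast
    field_simp
  rw [h']
  split_ifs with hn <;> simp [hn]

/-- The coefficient of `φ₃` at the index `q`, without the Gamma factor. -/
noncomputable def phi3Coeff (γ l₁ l₂ : ℝ) (q : ℕ × ℕ) : ℝ :=
  (pochDiv γ q.1 * (-l₁) ^ q.1) * (l₂ ^ q.2 / q.2.factorial)

lemma abs_phi3Coeff_le (γ l₁ l₂ : ℝ) (q : ℕ × ℕ) :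
    |phi3Coeff γ l₁ l₂ q| ≤ ((1 + |γ|) * |l₁|) ^ q.1 * |l₂| ^ q.2 := by
  rw [phi3Coeff, abs_mul, abs_mul, abs_pow, abs_neg, abs_div, abs_pow, Nat.abs_cast, mul_pow]
  have h := abs_pochDiv_le γ q.1
  have h1 : (1 : ℝ) ≤ q.2.factorial := by exact_mod_cast Nat.one_le_iff_ne_zero.2 (by positivity)
  have h2 : |l₂| ^ q.2 / q.2.factorial ≤ |l₂| ^ q.2 := div_le_self (by positivity) h1
  gcongr

/-- The Cauchy product of the coefficients of the two kernels is the unit. -/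
lemma sum_phi3Coeff_mul_phi3Coeff_neg (γ l₁ l₂ : ℝ) (p : ℕ × ℕ) :
    ∑ r ∈ antidiagonal p.1 ×ˢ antidiagonal p.2,
      phi3Coeff γ l₁ l₂ (r.1.1, r.2.1) * phi3Coeff (-γ) l₁ (-l₂) (r.1.2, r.2.2) =
      if p = 0 then 1 else 0 := by
  have h1 : ∑ r ∈ antidiagonal p.1,
      (pochDiv γ r.1 * (-l₁) ^ r.1) * (pochDiv (-γ) r.2 * (-l₁) ^ r.2) =
      if p.1 = 0 then 1 else 0 := by
    have : ∑ r ∈ antidiagonal p.1,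
        (pochDiv γ r.1 * (-l₁) ^ r.1) * (pochDiv (-γ) r.2 * (-l₁) ^ r.2) =
        (∑ r ∈ antidiagonal p.1, pochDiv γ r.1 * pochDiv (-γ) r.2) * (-l₁) ^ p.1 := by
      rw [Finset.sum_mul]
      refine Finset.sum_congr rfl fun r hr => ?_
      rw [← mem_antidiagonal.1 hr, pow_add]; ring
    rw [this, sum_antidiagonal_pochDiv_neg]
    split_ifs with h <;> simp [h]
  have h2 := sum_antidiagonal_pow_div_factorial_neg l₂ p.2
  calc _ = (∑ r ∈ antidiagonal p.1,
        (pochDiv γ r.1 * (-l₁) ^ r.1) * (pochDiv (-γ) r.2 * (-l₁) ^ r.2)) *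
        ∑ s ∈ antidiagonal p.2,
          l₂ ^ s.1 / s.1.factorial * ((-l₂) ^ s.2 / s.2.factorial) := by
        rw [Finset.sum_mul_sum, Finset.sum_product]
        refine Finset.sum_congr rfl fun r _ => Finset.sum_congr rfl fun s _ => ?_
        simp only [phi3Coeff]; ring
    _ = _ := by
        rw [h1, h2]
        by_cases h : p.1 = 0 <;> by_cases h' : p.2 = 0 <;> simp [h, h', Prod.ext_iff]

/-- The Riemann–Liouville kernel `t ^ (s - 1) / Γ(s)`. -/
noncomputable def rlKernel (s t : ℝ) : ℝ := t ^ (s - 1) / Real.Gamma s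

lemma rlKernel_pos {s t : ℝ} (hs : 0 < s) (ht : 0 < t) : 0 < rlKernel s t :=
  div_pos (Real.rpow_pos_of_pos ht _) (Real.Gamma_pos_of_pos hs)

lemma rlKernel_one (t : ℝ) : rlKernel 1 t = 1 := by simp [rlKernel]

/-- The semigroup property of the Riemann–Liouville kernels. -/
lemma integral_rlKernel_mul_rlKernel {s t x : ℝ} (hs : 0 < s) (ht : 0 < t) (hx : 0 < x) :
    ∫ ξ in (0 : ℝ)..x, rlKernel s (x - ξ) * rlKernel t ξ = rlKernel (s + t) x := by
  have key : ∫ ξ in (0 : ℝ)..x, ξ ^ (t - 1) * (x - ξ) ^ (s - 1) =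
      x ^ (t + s - 1) * (Real.Gamma t * Real.Gamma s / Real.Gamma (t + s)) := by
    have h := Complex.betaIntegral_scaled (t : ℂ) (s : ℂ) hx
    rw [Complex.betaIntegral_eq_Gamma_mul_div _ _ (by simpa) (by simpa)] at h
    have h' : ∫ ξ in (0 : ℝ)..x, (ξ : ℂ) ^ ((t : ℂ) - 1) * ((x : ℂ) - ξ) ^ ((s : ℂ) - 1) =
        ∫ ξ in (0 : ℝ)..x, ((ξ ^ (t - 1) * (x - ξ) ^ (s - 1) : ℝ) : ℂ) := by
      refine intervalIntegral.integral_congr fun ξ hξ => ?_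
      rw [Set.uIcc_of_le hx.le] at hξ
      rw [Complex.ofReal_mul, Complex.ofReal_cpow hξ.1, Complex.ofReal_cpow (sub_nonneg.2 hξ.2)]
      push_cast
      rfl
    rw [h', intervalIntegral.integral_ofReal, ← Complex.ofReal_add, Complex.Gamma_ofReal,
      Complex.Gamma_ofReal, Complex.Gamma_ofReal, ← Complex.ofReal_one, ← Complex.ofReal_sub,
      ← Complex.ofReal_cpow hx.le] at h
    exact_mod_cast h
  have h1 := (Real.Gamma_pos_of_pos hs).ne'
  have h2 := (Real.Gamma_pos_of_pos ht).ne'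
  have : ∀ ξ, rlKernel s (x - ξ) * rlKernel t ξ =
      (Real.Gamma s * Real.Gamma t)⁻¹ * (ξ ^ (t - 1) * (x - ξ) ^ (s - 1)) := fun ξ => by
    simp only [rlKernel]; field_simp
  simp_rw [this]
  rw [intervalIntegral.integral_const_mul, key, rlKernel, add_comm t s]
  field_simp

lemma integrableOn_rlKernel_mul_rlKernel {s t x : ℝ} (hs : 0 < s) (ht : 0 < t) (hx : 0 < x) :
    IntegrableOn (fun ξ => rlKernel s (x - ξ) * rlKernel t ξ) (Set.Ioo 0 x) := by
  apply Integrable.of_integral_ne_zero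
  rw [← integral_Ioc_eq_integral_Ioo, ← intervalIntegral.integral_of_le hx.le,
    integral_rlKernel_mul_rlKernel hs ht hx]
  exact (rlKernel_pos (by positivity) hx).ne'

lemma rpow_mul_exp_neg_le_Gamma_add_one {a s : ℝ} (ha : 0 < a) (hs : 0 < s) :
    a ^ s * Real.exp (-a) ≤ Real.Gamma (s + 1) := by
  rw [Real.Gamma_eq_integral (by positivity), ← integral_exp_neg_Ioi, ← integral_const_mul]
  have hInt := Real.GammaIntegral_convergent (s := s + 1) (by positivity)
  have hsub : Set.Ioi a ⊆ Set.Ioi 0 := Set.Ioi_subset_Ioi ha.le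
  calc ∫ t in Set.Ioi a, a ^ s * Real.exp (-t)
      ≤ ∫ t in Set.Ioi a, Real.exp (-t) * t ^ (s + 1 - 1) := by
        refine setIntegral_mono_on ?_ (hInt.mono_set hsub) measurableSet_Ioi fun t ht => ?_
        · exact (exp_neg_integrableOn_Ioi a one_pos |>.congr_fun (fun t _ => by simp)
            measurableSet_Ioi).const_mul _
        · rw [mul_comm, add_sub_cancel_right]
          exact mul_le_mul_of_nonneg_left (Real.rpow_le_rpow ha.le (le_of_lt ht) hs.le)
            (Real.exp_pos _).le
    _ ≤ _ := by
        refine setIntegral_mono_set hInt ?_ hsub.eventuallyLE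
        filter_upwards [ae_restrict_mem measurableSet_Ioi] with t ht
        have : (0 : ℝ) < t := ht
        simp only [Pi.zero_apply]
        positivity

/-- The Riemann–Liouville kernels decay faster than any exponential in the order. -/
lemma exists_rlKernel_le {t ε : ℝ} (ht : 0 < t) (hε : 0 < ε) :
    ∃ C, 0 ≤ C ∧ ∀ s, 0 < s → rlKernel s t ≤ C * ε ^ s := by
  set a : ℝ := Real.exp 1 * t / ε with ha_def
  have ha : 0 < a := by positivity
  refine ⟨t⁻¹ * Real.exp a, by positivity, fun s hs => ?_⟩
  have hG := Real.Gamma_pos_of_pos hs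
  have h := rpow_mul_exp_neg_le_Gamma_add_one ha hs
  rw [Real.Gamma_add_one hs.ne'] at h
  have h1 : s ≤ Real.exp 1 ^ s := by
    rw [← Real.exp_mul, one_mul]
    linarith [Real.add_one_le_exp s]
  have h2 : a ^ s * ε ^ s = Real.exp 1 ^ s * t ^ s := by
    rw [← Real.mul_rpow ha.le hε.le, ← Real.mul_rpow (Real.exp_pos _).le ht.le, ha_def,
      div_mul_cancel₀ _ hε.ne']
  have h3 : t ^ s ≤ Real.exp a * ε ^ s * Real.Gamma s := by
    have hE : 0 < Real.exp 1 ^ s := by positivity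
    refine le_of_mul_le_mul_left ?_ hE
    calc Real.exp 1 ^ s * t ^ s = Real.exp a * ε ^ s * (a ^ s * Real.exp (-a)) := by
          rw [← h2, Real.exp_neg]; field_simp
      _ ≤ Real.exp a * ε ^ s * (s * Real.Gamma s) := by gcongr
      _ ≤ Real.exp a * ε ^ s * (Real.exp 1 ^ s * Real.Gamma s) := by gcongr
      _ = _ := by ring
  rw [rlKernel, div_le_iff₀ hG, Real.rpow_sub_one ht.ne', div_eq_inv_mul, mul_assoc t⁻¹,
    mul_assoc t⁻¹]
  gcongr

lemma eventually_mul_rpow_lt_one {a α : ℝ} (hα : 0 < α) :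
    ∀ᶠ ε in nhdsWithin (0 : ℝ) (Set.Ioi 0), a * ε ^ α < 1 := by
  have h : Filter.Tendsto (fun ε : ℝ => a * ε ^ α) (nhdsWithin 0 (Set.Ioi 0)) (nhds 0) := by
    have := ((Real.continuousAt_rpow_const 0 α (Or.inr hα.le)).tendsto.const_mul a).mono_left
      (nhdsWithin_le_nhds (s := Set.Ioi (0 : ℝ)))
    simpa [Real.zero_rpow hα.ne'] using this
  exact h.eventually (gt_mem_nhds one_pos)

lemma exists_summable_mul_rpow {α₁ α₂ A B : ℝ} (hα₁ : 0 < α₁) (hα₂ : 0 < α₂) (hA : 0 ≤ A)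
    (hB : 0 ≤ B) : ∃ ε, 0 < ε ∧
      Summable fun q : ℕ × ℕ => A ^ q.1 * B ^ q.2 * ε ^ (α₁ * q.1 + α₂ * q.2) := by
  obtain ⟨ε, ⟨h1, h2⟩, h0⟩ := (((eventually_mul_rpow_lt_one (a := A) hα₁).and
    (eventually_mul_rpow_lt_one (a := B) hα₂)).and self_mem_nhdsWithin).exists
  have h0 : 0 < ε := h0
  refine ⟨ε, h0, ?_⟩
  have s1 := summable_geometric_of_lt_one (by positivity) h1
  have s2 := summable_geometric_of_lt_one (by positivity) h2
  refine (s1.mul_of_nonneg s2 (fun n => by positivity) (fun n => by positivity)).congr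
    fun q => ?_
  rw [Real.rpow_add h0, Real.rpow_mul h0.le, Real.rpow_mul h0.le, Real.rpow_natCast,
    Real.rpow_natCast, mul_pow, mul_pow]
  ring

lemma summable_phi3Coeff_mul_rlKernel {γ l₁ l₂ α₁ α₂ b t : ℝ} (hα₁ : 0 < α₁) (hα₂ : 0 < α₂)
    (hb : 0 < b) (ht : 0 < t) :
    Summable fun q : ℕ × ℕ =>
      ‖phi3Coeff γ l₁ l₂ q * rlKernel (α₁ * q.1 + α₂ * q.2 + b) t‖ := by
  obtain ⟨ε, hε, hs⟩ := exists_summable_mul_rpow (A := (1 + |γ|) * |l₁|) (B := |l₂|) hα₁ hα₂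
    (by positivity) (by positivity)
  obtain ⟨C, hC, hle⟩ := exists_rlKernel_le ht hε
  refine (hs.mul_right (C * ε ^ b)).of_nonneg_of_le (fun _ => norm_nonneg _) fun q => ?_
  have hpos : 0 < α₁ * q.1 + α₂ * q.2 + b := by positivity
  have h := hle _ hpos
  rw [Real.rpow_add hε] at h
  rw [norm_mul, Real.norm_of_nonneg (rlKernel_pos hpos ht).le]
  refine (mul_le_mul (abs_phi3Coeff_le γ l₁ l₂ q) h (rlKernel_pos hpos ht).le
    (by positivity)).trans_eq ?_
  ring

lemma summable_phi3Coeff_mul_phi3Coeff_mul_rlKernel {γ l₁ l₂ α₁ α₂ x : ℝ} (hα₁ : 0 < α₁)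
    (hα₂ : 0 < α₂) (hx : 0 < x) :
    Summable fun p : (ℕ × ℕ) × (ℕ × ℕ) =>
      ‖phi3Coeff γ l₁ l₂ p.1 * phi3Coeff (-γ) l₁ (-l₂) p.2‖ *
        rlKernel (α₁ * (p.1 + p.2).1 + α₂ * (p.1 + p.2).2 + 1) x := by
  obtain ⟨ε, hε, hs⟩ := exists_summable_mul_rpow (A := (1 + |γ|) * |l₁|) (B := |l₂|) hα₁ hα₂
    (by positivity) (by positivity)
  obtain ⟨C, hC, hle⟩ := exists_rlKernel_le hx hε
  have hs2 := hs.mul_of_nonneg hs (fun q => by positivity) (fun q => by positivity)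
  refine (hs2.mul_right (C * ε)).of_nonneg_of_le (fun p => ?_) fun p => ?_
  · exact mul_nonneg (norm_nonneg _) (rlKernel_pos (by positivity) hx).le
  have hpos : 0 < α₁ * ((p.1 + p.2).1 : ℕ) + α₂ * ((p.1 + p.2).2 : ℕ) + 1 := by positivity
  have h := hle _ hpos
  have hsplit : ε ^ (α₁ * ((p.1 + p.2).1 : ℕ) + α₂ * ((p.1 + p.2).2 : ℕ) + 1) =
      ε ^ (α₁ * p.1.1 + α₂ * p.1.2) * ε ^ (α₁ * p.2.1 + α₂ * p.2.2) * ε := by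
    rw [← Real.rpow_add hε, ← Real.rpow_add_one hε.ne']
    congr 1
    push_cast [Prod.fst_add, Prod.snd_add]
    ring
  rw [hsplit] at h
  have h1 := abs_phi3Coeff_le γ l₁ l₂ p.1
  have h2 := abs_phi3Coeff_le (-γ) l₁ (-l₂) p.2
  rw [abs_neg, abs_neg] at h2
  rw [norm_mul]
  refine (mul_le_mul (mul_le_mul h1 h2 (abs_nonneg _) (by positivity)) h
    (rlKernel_pos hpos hx).le (by positivity)).trans_eq ?_
  ring

lemma rpow_mul_phi3 {γ l₁ l₂ α₁ α₂ b t : ℝ} (ht : 0 < t) :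
    t ^ (b - 1) * phi3 γ α₁ α₂ b (-(l₁ * t ^ α₁)) (l₂ * t ^ α₂) =
      ∑' q : ℕ × ℕ, phi3Coeff γ l₁ l₂ q * rlKernel (α₁ * q.1 + α₂ * q.2 + b) t := by
  rw [phi3, ← tsum_mul_left]
  refine tsum_congr fun q => ?_
  rw [rlKernel, add_sub_assoc, Real.rpow_add ht, Real.rpow_add ht, Real.rpow_mul ht.le,
    Real.rpow_mul ht.le, Real.rpow_natCast, Real.rpow_natCast, ← neg_mul, mul_pow, mul_pow,
    phi3Coeff, pochDiv]
  have h1 : (q.1.factorial : ℝ) ≠ 0 := by positivity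
  have h2 : (q.2.factorial : ℝ) ≠ 0 := by positivity
  field_simp

/-- Summation along the fibres of addition collapses to the index `0`. -/
lemma hasSum_phi3Coeff_mul_phi3Coeff_mul_rlKernel {γ l₁ l₂ α₁ α₂ x : ℝ} (hα₁ : 0 < α₁)
    (hα₂ : 0 < α₂) (hx : 0 < x) :
    HasSum (fun p : (ℕ × ℕ) × (ℕ × ℕ) =>
      phi3Coeff γ l₁ l₂ p.1 * phi3Coeff (-γ) l₁ (-l₂) p.2 *
        rlKernel (α₁ * (p.1 + p.2).1 + α₂ * (p.1 + p.2).2 + 1) x) 1 := by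
  have hsum : Summable fun p : (ℕ × ℕ) × (ℕ × ℕ) =>
      phi3Coeff γ l₁ l₂ p.1 * phi3Coeff (-γ) l₁ (-l₂) p.2 *
        rlKernel (α₁ * (p.1 + p.2).1 + α₂ * (p.1 + p.2).2 + 1) x := by
    refine Summable.of_norm ((summable_phi3Coeff_mul_phi3Coeff_mul_rlKernel (γ := γ) (l₁ := l₁)
      (l₂ := l₂) hα₁ hα₂ hx).congr fun p => ?_)
    rw [norm_mul _ (rlKernel _ _), Real.norm_of_nonneg (rlKernel_pos (by positivity) hx).le]
  have hfib := hsum.hasSum.tsum_fiberwise fun p => p.1 + p.2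
  have hval : ∀ c : ℕ × ℕ, (∑' p : (fun p : (ℕ × ℕ) × (ℕ × ℕ) => p.1 + p.2) ⁻¹' {c},
      phi3Coeff γ l₁ l₂ p.1.1 * phi3Coeff (-γ) l₁ (-l₂) p.1.2 *
        rlKernel (α₁ * (p.1.1 + p.1.2).1 + α₂ * (p.1.1 + p.1.2).2 + 1) x) =
      if c = 0 then 1 else 0 := fun c => by
    have hset : (fun p : (ℕ × ℕ) × (ℕ × ℕ) => p.1 + p.2) ⁻¹' {c} =
        ((antidiagonal c.1 ×ˢ antidiagonal c.2).map
          (Equiv.prodProdProdComm ℕ ℕ ℕ ℕ).toEmbedding : Finset _) := by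
      ext ⟨⟨a, b⟩, ⟨a', b'⟩⟩
      simp [Prod.ext_iff, Equiv.prodProdProdComm]
    rw [hset, Finset.tsum_subtype' _ fun p : (ℕ × ℕ) × (ℕ × ℕ) =>
      phi3Coeff γ l₁ l₂ p.1 * phi3Coeff (-γ) l₁ (-l₂) p.2 *
        rlKernel (α₁ * (p.1 + p.2).1 + α₂ * (p.1 + p.2).2 + 1) x, Finset.sum_map]
    have : ∀ r ∈ antidiagonal c.1 ×ˢ antidiagonal c.2,
        phi3Coeff γ l₁ l₂ (r.1.1, r.2.1) * phi3Coeff (-γ) l₁ (-l₂) (r.1.2, r.2.2) *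
          rlKernel (α₁ * ((r.1.1 + r.1.2 : ℕ) : ℝ) + α₂ * ((r.2.1 + r.2.2 : ℕ) : ℝ) + 1) x =
        phi3Coeff γ l₁ l₂ (r.1.1, r.2.1) * phi3Coeff (-γ) l₁ (-l₂) (r.1.2, r.2.2) *
          rlKernel (α₁ * c.1 + α₂ * c.2 + 1) x := fun r hr => by
      rw [Finset.mem_product, mem_antidiagonal, mem_antidiagonal] at hr
      rw [hr.1, hr.2]
    refine (Finset.sum_congr rfl this).trans ?_
    rw [← Finset.sum_mul, sum_phi3Coeff_mul_phi3Coeff_neg]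
    split_ifs with h
    · simp [h, rlKernel_one]
    · simp
  have htot : HasSum (fun c : ℕ × ℕ => if c = 0 then (1 : ℝ) else 0) 1 := by
    simpa using hasSum_ite_eq (0 : ℕ × ℕ) (1 : ℝ)
  exact hsum.hasSum_iff.2 ((hfib.congr_fun fun c => (hval c).symm).unique htot)

/-- The kernels `x^{β-1}φ₃(γ;(α₁,α₂;β);-λ₁x^{α₁},λ₂x^{α₂})` and
`x^{-β}φ₃(-γ;(α₁,α₂;1-β);-λ₁x^{α₁},-λ₂x^{α₂})` form a pair of Sonin kernels. -/
theorem phi3_kernels_sonin (α₁ α₂ β γ lam₁ lam₂ : ℝ)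
    (hβ0 : 0 < β) (hβ1 : β < 1) (hα₁ : 0 < α₁) (hα₂ : 0 < α₂)
    (x : ℝ) (hx : 0 < x) :
    ∫ ξ in (0:ℝ)..x,
      ((x - ξ) ^ (β - 1) * phi3 γ α₁ α₂ β (-(lam₁ * (x - ξ) ^ α₁)) (lam₂ * (x - ξ) ^ α₂)) *
      (ξ ^ (-β) * phi3 (-γ) α₁ α₂ (1 - β) (-(lam₁ * ξ ^ α₁)) (-(lam₂ * ξ ^ α₂))) = 1 := by
  have hβ' : 0 < 1 - β := sub_pos.2 hβ1
  let F : (ℕ × ℕ) × (ℕ × ℕ) → ℝ → ℝ := fun p ξ =>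
    (phi3Coeff γ lam₁ lam₂ p.1 * rlKernel (α₁ * p.1.1 + α₂ * p.1.2 + β) (x - ξ)) *
    (phi3Coeff (-γ) lam₁ (-lam₂) p.2 * rlKernel (α₁ * p.2.1 + α₂ * p.2.2 + (1 - β)) ξ)
  have hF : ∀ p ξ, F p ξ = phi3Coeff γ lam₁ lam₂ p.1 * phi3Coeff (-γ) lam₁ (-lam₂) p.2 *
      (rlKernel (α₁ * p.1.1 + α₂ * p.1.2 + β) (x - ξ) *
        rlKernel (α₁ * p.2.1 + α₂ * p.2.2 + (1 - β)) ξ) := fun p ξ => mul_mul_mul_comm _ _ _ _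
  have hker : ∀ p : (ℕ × ℕ) × (ℕ × ℕ), ∫ ξ in Set.Ioo 0 x,
      rlKernel (α₁ * p.1.1 + α₂ * p.1.2 + β) (x - ξ) *
        rlKernel (α₁ * p.2.1 + α₂ * p.2.2 + (1 - β)) ξ =
      rlKernel (α₁ * (p.1 + p.2).1 + α₂ * (p.1 + p.2).2 + 1) x := fun p => by
    rw [← integral_Ioc_eq_integral_Ioo, ← intervalIntegral.integral_of_le hx.le,
      integral_rlKernel_mul_rlKernel (by positivity) (by positivity) hx]
    congr 1
    push_cast [Prod.fst_add, Prod.snd_add]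
    ring
  have hInt : ∀ p, Integrable (F p) (volume.restrict (Set.Ioo 0 x)) := fun p => by
    rw [funext (hF p)]
    exact (integrableOn_rlKernel_mul_rlKernel (by positivity) (by positivity) hx).const_mul _
  have hnorm : ∀ p, ∫ ξ in Set.Ioo 0 x, ‖F p ξ‖ =
      ‖phi3Coeff γ lam₁ lam₂ p.1 * phi3Coeff (-γ) lam₁ (-lam₂) p.2‖ *
        rlKernel (α₁ * (p.1 + p.2).1 + α₂ * (p.1 + p.2).2 + 1) x := fun p => by
    rw [← hker, ← integral_const_mul]
    refine setIntegral_congr_fun measurableSet_Ioo fun ξ hξ => ?_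
    have h1 := rlKernel_pos (s := α₁ * p.1.1 + α₂ * p.1.2 + β) (by positivity) (sub_pos.2 hξ.2)
    have h2 := rlKernel_pos (s := α₁ * p.2.1 + α₂ * p.2.2 + (1 - β)) (by positivity) hξ.1
    rw [hF, norm_mul _ (rlKernel _ _ * rlKernel _ _), Real.norm_of_nonneg (mul_pos h1 h2).le]
  have hswap := hasSum_integral_of_summable_integral_norm hInt
    ((summable_phi3Coeff_mul_phi3Coeff_mul_rlKernel hα₁ hα₂ hx).congr fun p => (hnorm p).symm)
  have hterm : ∀ p, ∫ ξ in Set.Ioo 0 x, F p ξ =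
      phi3Coeff γ lam₁ lam₂ p.1 * phi3Coeff (-γ) lam₁ (-lam₂) p.2 *
        rlKernel (α₁ * (p.1 + p.2).1 + α₂ * (p.1 + p.2).2 + 1) x := fun p => by
    simp_rw [hF]
    rw [integral_const_mul, hker]
  simp_rw [hterm] at hswap
  rw [intervalIntegral.integral_of_le hx.le, integral_Ioc_eq_integral_Ioo]
  refine Eq.trans ?_ (hswap.unique (hasSum_phi3Coeff_mul_phi3Coeff_mul_rlKernel hα₁ hα₂ hx))
  refine setIntegral_congr_fun measurableSet_Ioo fun ξ hξ => ?_
  have hexp : -β = 1 - β - 1 := by ring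
  rw [← neg_mul lam₂, hexp, rpow_mul_phi3 (sub_pos.2 hξ.2), rpow_mul_phi3 hξ.1]
  exact tsum_mul_tsum_of_summable_norm
    (summable_phi3Coeff_mul_rlKernel hα₁ hα₂ hβ0 (sub_pos.2 hξ.2))
    (summable_phi3Coeff_mul_rlKernel hα₁ hα₂ hβ' hξ.1)
end
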